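/- Discrete Painlevé II equation for the modified circular Jacobi weight: let t ∈ ℝ, t ≠ 0, λ > −1/2, and w(θ) = e^{t cos θ}(sin²(θ/2))^λ. Then all Verblunsky coefficients α_n of the MOPUC for w are real with |α_n| < 1, and for every n ≥ 3 they satisfy α_n + α_{n−2} = −(2/t)·[λ + (λ+n)α_{n−1}]/(1 − α_{n−1}²). -/

import Mathlib

open Polynomial MeasureTheory

section Algebra

variable {K : Type*} [Field K]

/-- The functional `p ↦ L (p(z) z⁻ᵏ)`, where `L` has moments `L (zʲ) = μ j`. -/
noncomputable def shiftedMoment (μ : ℤ → K) (k : ℤ) : K[X] →ₗ[K] K :=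
  Polynomial.lsum fun i => μ (i - k) • LinearMap.id

theorem shiftedMoment_C_mul_X_pow (μ : ℤ → K) (k : ℤ) (c : K) (i : ℕ) :
    shiftedMoment μ k (C c * X ^ i) = c * μ (i - k) := by
  rw [C_mul_X_pow_eq_monomial, shiftedMoment, lsum_apply, sum_monomial_index] <;> simp [mul_comm]

theorem shiftedMoment_C_mul (μ : ℤ → K) (k : ℤ) (c : K) (p : K[X]) :
    shiftedMoment μ k (C c * p) = c * shiftedMoment μ k p := by
  rw [← smul_eq_C_mul, map_smul, smul_eq_mul]

theorem shiftedMoment_X_mul (μ : ℤ → K) (k : ℤ) (p : K[X]) :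
    shiftedMoment μ k (X * p) = shiftedMoment μ (k - 1) p := by
  induction p using Polynomial.induction_on' with
  | add p q hp hq => rw [mul_add, map_add, map_add, hp, hq]
  | monomial i c =>
    rw [← C_mul_X_pow_eq_monomial, show X * (C c * X ^ i) = C c * X ^ (i + 1) by ring,
      shiftedMoment_C_mul_X_pow, shiftedMoment_C_mul_X_pow]
    congr 2
    push_cast
    ring

theorem shiftedMoment_X_pow_mul (μ : ℤ → K) (k : ℤ) (i : ℕ) (p : K[X]) :
    shiftedMoment μ k (X ^ i * p) = shiftedMoment μ (k - i) p := by
  induction i generalizing k with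
  | zero => simp
  | succ i ih =>
    rw [pow_succ', mul_assoc, shiftedMoment_X_mul, ih]
    congr 1
    push_cast
    ring_nf

theorem shiftedMoment_mul (μ : ℤ → K) (k : ℤ) (p : K[X]) {q : K[X]} {d : ℕ}
    (hq : q.natDegree ≤ d) :
    shiftedMoment μ k (p * q) =
      ∑ j ∈ Finset.range (d + 1), q.coeff j * shiftedMoment μ (k - j) p := by
  conv_lhs => rw [q.as_sum_range_C_mul_X_pow' (Nat.lt_succ_of_le hq)]
  rw [Finset.mul_sum, map_sum]
  refine Finset.sum_congr rfl fun j _ => ?_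
  rw [show p * (C (q.coeff j) * X ^ j) = C (q.coeff j) * (X ^ j * p) by ring,
    shiftedMoment_C_mul, shiftedMoment_X_pow_mul]

theorem shiftedMoment_reflect {μ : ℤ → K} (hμ : ∀ k, μ (-k) = μ k) (k : ℤ) {N : ℕ} {p : K[X]}
    (hp : p.natDegree ≤ N) :
    shiftedMoment μ k (reflect N p) = shiftedMoment μ (N - k) p := by
  refine induction_with_natDegree_le
    (fun p => shiftedMoment μ k (reflect N p) = shiftedMoment μ (N - k) p) N (by simp)
    (fun i c _ hi => ?_) (fun f g _ _ hf hg => ?_) p hp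
  · rw [reflect_C_mul_X_pow, revAt_le hi, shiftedMoment_C_mul_X_pow, shiftedMoment_C_mul_X_pow,
      ← hμ, Nat.cast_sub hi]
    congr 2
    ring
  · rw [reflect_add, map_add, map_add, hf, hg]

/-- The moment functional annihilates the derivatives attached to a semiclassical weight. -/
theorem shiftedMoment_pearson {μ : ℤ → K} {lam τ : K}
    (hp : ∀ k : ℤ, (k + 1 + lam) * μ (k + 1) + (lam - k) * μ k +
      τ * (μ (k + 2) - μ (k + 1) - μ k + μ (k - 1)) = 0) (k : ℤ) (p : K[X]) :
    shiftedMoment μ k (X * ((X - 1) * derivative p)) - k * shiftedMoment μ k ((X - 1) * p) +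
      (1 + lam - τ) * shiftedMoment μ (k - 1) p + (lam - τ) * shiftedMoment μ k p +
      τ * (shiftedMoment μ (k - 2) p + shiftedMoment μ (k + 1) p) = 0 := by
  induction p using Polynomial.induction_on' with
  | add p q hp hq =>
    simp only [mul_add, map_add] at hp hq ⊢
    linear_combination hp + hq
  | monomial i c =>
    have e : X * ((X - 1) * derivative (monomial i c)) =
        C (i : K) * (X * monomial i c - monomial i c) := by
      rcases i with _ | i
      · simp
      · rw [derivative_monomial, ← C_mul_X_pow_eq_monomial, ← C_mul_X_pow_eq_monomial, C_mul]
        rw [add_tsub_cancel_right]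
        ring
    rw [e, sub_mul, one_mul, shiftedMoment_C_mul, map_sub, shiftedMoment_X_mul,
      ← C_mul_X_pow_eq_monomial]
    simp only [shiftedMoment_C_mul_X_pow]
    have := hp (i - k)
    rw [show (i : ℤ) - k + 1 = i - (k - 1) by ring, show (i : ℤ) - k + 2 = i - (k - 2) by ring,
      show (i : ℤ) - k - 1 = i - (k + 1) by ring] at this
    push_cast at this
    linear_combination c * this

/-- Monic polynomials orthogonal with respect to a symmetric non-degenerate Toeplitz functional. -/
structure IsToeplitzOrthogonal (μ : ℤ → K) (P : ℕ → K[X]) : Prop where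
  symm : ∀ k, μ (-k) = μ k
  nondegenerate : ∀ (n : ℕ) (E : K[X]), E.degree < n →
    (∀ k : ℕ, k < n → shiftedMoment μ k E = 0) → E = 0
  monic : ∀ n, (P n).Monic
  natDegree_eq : ∀ n, (P n).natDegree = n
  orthogonal : ∀ n k : ℕ, k < n → shiftedMoment μ k (P n) = 0

namespace IsToeplitzOrthogonal

variable {μ : ℤ → K} {P : ℕ → K[X]} (h : IsToeplitzOrthogonal μ P)
include h

theorem norm_ne_zero (n : ℕ) : shiftedMoment μ n (P n) ≠ 0 := fun h0 => by
  refine (h.monic n).ne_zero (h.nondegenerate (n + 1) _ ?_ fun k hk => ?_)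
  · rw [degree_eq_natDegree (h.monic n).ne_zero, h.natDegree_eq]
    exact_mod_cast Nat.lt_succ_self n
  · rcases Nat.lt_succ_iff_lt_or_eq.mp hk with hk | rfl
    · exact h.orthogonal n k hk
    · exact h0

theorem natDegree_reflect_le (n : ℕ) : (reflect n (P n)).natDegree ≤ n := by
  simpa [h.natDegree_eq] using Polynomial.natDegree_reflect_le (N := n) (p := P n)

theorem coeff_self (n : ℕ) : (P n).coeff n = 1 := by
  have := (h.monic n).coeff_natDegree
  rwa [h.natDegree_eq] at this

theorem coeff_zero_reflect (n : ℕ) : (reflect n (P n)).coeff 0 = 1 := by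
  rw [coeff_reflect, revAt_le (Nat.zero_le n), Nat.sub_zero, h.coeff_self]

/-- The Szegő recurrence. -/
theorem X_mul_eq (n : ℕ) :
    X * P n = P (n + 1) + C (-(P (n + 1)).coeff 0) * reflect n (P n) := by
  set b := -(P (n + 1)).coeff 0 with hb
  have h0 : (X * P n - P (n + 1) - C b * reflect n (P n)).coeff 0 = 0 := by
    simp [h.coeff_zero_reflect, hb]
  obtain ⟨E, hE⟩ := X_dvd_iff.mpr h0
  have hE0 : E = 0 := by
    refine h.nondegenerate n E ?_ fun k hk => ?_
    · rw [degree_lt_iff_coeff_zero]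
      intro m hm
      have := congrArg (fun q => coeff q (m + 1)) hE
      simp only [coeff_sub, coeff_X_mul, coeff_C_mul] at this
      rw [← this, coeff_eq_zero_of_natDegree_lt ((h.natDegree_reflect_le n).trans_lt (by omega))]
      rcases eq_or_lt_of_le hm with rfl | hm
      · simp [h.coeff_self]
      · rw [coeff_eq_zero_of_natDegree_lt (by rw [h.natDegree_eq]; omega),
          coeff_eq_zero_of_natDegree_lt (by rw [h.natDegree_eq]; omega)]
        simp
    · have := congrArg (shiftedMoment μ (k + 1)) hE
      rw [shiftedMoment_X_mul, map_sub, map_sub, shiftedMoment_C_mul, shiftedMoment_X_mul,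
        shiftedMoment_reflect h.symm _ (h.natDegree_eq n).le] at this
      have e1 := h.orthogonal n k hk
      have e2 := h.orthogonal (n + 1) (k + 1) (by omega)
      have e3 := h.orthogonal n (n - (k + 1)) (by omega)
      rw [Nat.cast_sub (by omega)] at e3
      push_cast at e2 e3
      rw [e2, e3, add_sub_cancel_right, e1] at this
      simpa using this.symm
  rw [hE0, mul_zero, sub_eq_zero, sub_eq_iff_eq_add'] at hE
  exact hE

theorem shiftedMoment_neg_one (n : ℕ) :
    shiftedMoment μ (-1) (P n) = -(P (n + 1)).coeff 0 * shiftedMoment μ n (P n) := by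
  have := congrArg (shiftedMoment μ 0) (h.X_mul_eq n)
  have e := h.orthogonal (n + 1) 0 (by omega)
  rw [Nat.cast_zero] at e
  rwa [shiftedMoment_X_mul, map_add, shiftedMoment_C_mul, e,
    shiftedMoment_reflect h.symm _ (h.natDegree_eq n).le, zero_add, zero_sub, sub_zero] at this

theorem norm_succ (n : ℕ) :
    shiftedMoment μ (n + 1 : ℕ) (P (n + 1)) =
      (1 - (P (n + 1)).coeff 0 ^ 2) * shiftedMoment μ n (P n) := by
  have := congrArg (shiftedMoment μ (n + 1 : ℕ)) (h.X_mul_eq n)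
  rw [shiftedMoment_X_mul, map_add, shiftedMoment_C_mul,
    shiftedMoment_reflect h.symm _ (h.natDegree_eq n).le] at this
  push_cast at this ⊢
  rw [add_sub_cancel_right, show (n : ℤ) - (n + 1) = -1 by ring, h.shiftedMoment_neg_one] at this
  linear_combination -this

theorem shiftedMoment_mul_of_natDegree_le {n : ℕ} {q : K[X]} (hq : q.natDegree ≤ n) :
    shiftedMoment μ n (P n * q) = q.coeff 0 * shiftedMoment μ n (P n) := by
  rw [shiftedMoment_mul μ _ _ hq, Finset.sum_eq_single 0]
  · simp
  · intro j hj hj0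
    have e := h.orthogonal n (n - j) (by grind)
    rw [Nat.cast_sub (by grind)] at e
    rw [e, mul_zero]
  · simp

theorem shiftedMoment_mul_eq_zero {n k : ℕ} (hk : k < n) {q : K[X]} (hq : q.natDegree ≤ k) :
    shiftedMoment μ k (P n * q) = 0 := by
  rw [shiftedMoment_mul μ _ _ hq]
  refine Finset.sum_eq_zero fun j hj => ?_
  have e := h.orthogonal n (k - j) (by omega)
  rw [Nat.cast_sub (by grind)] at e
  rw [e, mul_zero]

theorem shiftedMoment_mul_sub_one {n d : ℕ} (hd : d ≤ n) {q : K[X]} (hq : q.natDegree ≤ d) :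
    shiftedMoment μ (d - 1) (P n * q) = q.coeff d * shiftedMoment μ (-1) (P n) := by
  rw [shiftedMoment_mul μ _ _ hq, Finset.sum_eq_single d]
  · rw [show (d : ℤ) - 1 - d = -1 by ring]
  · intro j hj hj0
    have e := h.orthogonal n (d - (j + 1)) (by grind)
    rw [Nat.cast_sub (by grind)] at e
    push_cast at e
    rw [show (d : ℤ) - 1 - j = d - (j + 1) by ring, e, mul_zero]
  · simp

theorem shiftedMoment_mul_self (n : ℕ) :
    shiftedMoment μ n (P n * P n) = (P n).coeff 0 * shiftedMoment μ n (P n) :=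
  h.shiftedMoment_mul_of_natDegree_le (h.natDegree_eq n).le

theorem shiftedMoment_sub_one_mul_self (n : ℕ) :
    shiftedMoment μ (n - 1) (P n * P n) =
      -(P (n + 1)).coeff 0 * shiftedMoment μ n (P n) := by
  rw [h.shiftedMoment_mul_sub_one le_rfl (h.natDegree_eq n).le, h.coeff_self, one_mul,
    h.shiftedMoment_neg_one]

theorem shiftedMoment_reflect_mul_self (n : ℕ) :
    shiftedMoment μ (n - 1) (reflect n (P n) * P n) =
      -(P (n + 1)).coeff 0 * (P n).coeff 0 * shiftedMoment μ n (P n) := by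
  have hd := (h.natDegree_eq n).le
  rw [← shiftedMoment_X_mul, show X * (reflect n (P n) * P n) = X * P n * reflect n (P n) by ring,
    h.X_mul_eq, add_mul, map_add,
    h.shiftedMoment_mul_eq_zero (Nat.lt_succ_self n) (h.natDegree_reflect_le n), mul_assoc,
    shiftedMoment_C_mul, ← reflect_mul _ _ hd hd,
    shiftedMoment_reflect h.symm _ (natDegree_mul_le.trans (add_le_add hd hd))]
  push_cast
  rw [add_sub_cancel_right, h.shiftedMoment_mul_self]
  ring

theorem shiftedMoment_sub_two_mul_self (n : ℕ) :
    shiftedMoment μ (n - 2) (P n * P n) =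
      (-(P (n + 2)).coeff 0 * (1 - (P (n + 1)).coeff 0 ^ 2) +
        (P (n + 1)).coeff 0 ^ 2 * (P n).coeff 0) * shiftedMoment μ n (P n) := by
  rw [show (n : ℤ) - 2 = n - 1 - 1 by ring, ← shiftedMoment_X_mul, ← mul_assoc, h.X_mul_eq, add_mul,
    map_add, mul_assoc, shiftedMoment_C_mul, h.shiftedMoment_reflect_mul_self,
    h.shiftedMoment_mul_sub_one (Nat.le_succ n) (h.natDegree_eq n).le, h.coeff_self, one_mul,
    h.shiftedMoment_neg_one, h.norm_succ]
  ring

theorem shiftedMoment_add_one_mul_self (n : ℕ) :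
    shiftedMoment μ (n + 2) (P (n + 1) * P (n + 1)) =
      ((P n).coeff 0 - (P (n + 1)).coeff 0 ^ 2 * ((P (n + 2)).coeff 0 + (P n).coeff 0)) *
        shiftedMoment μ (n + 1 : ℕ) (P (n + 1)) := by
  have hd := (h.natDegree_eq n).le
  have hd' := (h.natDegree_eq (n + 1)).le
  set b := -(P (n + 1)).coeff 0 with hb
  have hX := h.X_mul_eq n
  have e1 : shiftedMoment μ (n + 1) (P (n + 1) * P n) =
      (P n).coeff 0 * shiftedMoment μ (n + 1 : ℕ) (P (n + 1)) := by
    exact_mod_cast h.shiftedMoment_mul_of_natDegree_le (hd.trans (Nat.le_succ n))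
  have e2 : shiftedMoment μ (n + 2) (P (n + 1) * reflect n (P n)) =
      b * ((P (n + 2)).coeff 0 + (P n).coeff 0) * shiftedMoment μ (n + 1 : ℕ) (P (n + 1)) := by
    have hr := h.natDegree_reflect_le (n + 1)
    have e3 := shiftedMoment_reflect h.symm (n + 2) (natDegree_mul_le.trans (add_le_add hr hd))
    have e4 := shiftedMoment_reflect h.symm n (natDegree_mul_le.trans (add_le_add hd' hd))
    have e5 := h.shiftedMoment_reflect_mul_self (n + 1)
    rw [reflect_mul _ _ hr hd, reflect_reflect] at e3
    rw [reflect_mul _ _ hd' hd] at e4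
    push_cast at e3 e4 e5 ⊢
    rw [show (n : ℤ) + 1 + n - (n + 2) = n - 1 by ring, ← shiftedMoment_X_mul,
      show X * (reflect (n + 1) (P (n + 1)) * P n) = reflect (n + 1) (P (n + 1)) * (X * P n) by ring,
      hX, mul_add, map_add, ← hb, mul_left_comm, shiftedMoment_C_mul, e4,
      show (n : ℤ) + 1 + n - n = n + 1 by ring, e1] at e3
    rw [add_sub_cancel_right] at e5
    rw [e3, e5, hb]
    push_cast
    ring
  have e6 : P (n + 1) * P (n + 1) =
      X * (P (n + 1) * P n) - C b * (P (n + 1) * reflect n (P n)) := by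
    linear_combination -P (n + 1) * hX
  rw [e6, map_sub, shiftedMoment_X_mul, shiftedMoment_C_mul, e2,
    show (n : ℤ) + 2 - 1 = n + 1 by ring, e1, hb]
  ring

/-- The discrete Painlevé II equation, in the form of an integrated recurrence. -/
theorem painleve {lam τ : K}
    (hp : ∀ k : ℤ, (k + 1 + lam) * μ (k + 1) + (lam - k) * μ k +
      τ * (μ (k + 2) - μ (k + 1) - μ k + μ (k - 1)) = 0) (n : ℕ) :
    (n + 1 + lam) * (P (n + 1)).coeff 0 +
      τ * (1 - (P (n + 1)).coeff 0 ^ 2) * ((P (n + 2)).coeff 0 + (P n).coeff 0) = lam := by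
  have key (n : ℕ) (x : K) (hx : shiftedMoment μ (n + 1) (P n * P n) =
      x * shiftedMoment μ n (P n)) :
      -(n + 1 + lam) * (P (n + 1)).coeff 0 + (n + lam - τ) * (P n).coeff 0
        + τ * (P (n + 1)).coeff 0 + τ * (-(P (n + 2)).coeff 0 * (1 - (P (n + 1)).coeff 0 ^ 2) +
        (P (n + 1)).coeff 0 ^ 2 * (P n).coeff 0 + x) = 0 := by
    have hS : ((X - 1) * derivative (P n)).natDegree ≤ n := by
      rcases n with _ | n
      · have : derivative (P 0) = 0 := by
          rw [eq_C_of_natDegree_eq_zero (h.natDegree_eq 0), derivative_C]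
        simp [this]
      · refine natDegree_mul_le.trans ?_
        have := natDegree_derivative_le (P (n + 1))
        rw [h.natDegree_eq] at this
        have := natDegree_X_sub_C_le (1 : K)
        rw [C_1] at this
        omega
    have hc : ((X - 1) * derivative (P n)).coeff n = (n : K) := by
      have h1 : ((derivative (P n))).coeff n = 0 := by
        rw [coeff_derivative, coeff_eq_zero_of_natDegree_lt (by rw [h.natDegree_eq]; omega),
          zero_mul]
      rw [sub_mul, coeff_sub, one_mul, h1, sub_zero]
      rcases n with _ | n
      · simp
      · rw [coeff_X_mul, coeff_derivative, h.coeff_self]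
        push_cast
        ring
    have h1 := h.shiftedMoment_mul_sub_one le_rfl hS
    rw [hc, h.shiftedMoment_neg_one] at h1
    have h2 := shiftedMoment_pearson hp n (P n * P n)
    rw [derivative_mul, show X * ((X - 1) * (derivative (P n) * P n + P n * derivative (P n))) =
      C 2 * (X * (P n * ((X - 1) * derivative (P n)))) by rw [C_ofNat]; ring, shiftedMoment_C_mul,
      shiftedMoment_X_mul, h1, sub_mul, one_mul, map_sub, shiftedMoment_X_mul,
      h.shiftedMoment_sub_two_mul_self, h.shiftedMoment_mul_self,
      h.shiftedMoment_sub_one_mul_self, hx] at h2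
    refine (mul_eq_zero.mp ?_).resolve_right (h.norm_ne_zero n)
    push_cast at h2
    linear_combination h2
  have hc0 : (P 0).coeff 0 = 1 := h.coeff_self 0
  induction n with
  | zero =>
    have hP0 : P 0 = 1 := by
      rw [eq_C_of_natDegree_eq_zero (h.natDegree_eq 0), hc0, C_1]
    have h1 := h.shiftedMoment_neg_one 0
    rw [hP0] at h1
    have h2 := key 0 (-(P 1).coeff 0) (by
      have := shiftedMoment_C_mul_X_pow μ 1 1 0
      have := shiftedMoment_C_mul_X_pow μ (-1) 1 0
      have := h.symm 1
      rw [hP0]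
      simp_all)
    rw [hc0] at h2
    push_cast at h2 ⊢
    simp only [zero_add] at h2 ⊢
    rw [hc0]
    linear_combination -h2
  | succ n ih =>
    have h2 := key (n + 1) _ (by
      push_cast
      rw [add_assoc, one_add_one_eq_two]
      exact h.shiftedMoment_add_one_mul_self n)
    push_cast at h2 ⊢
    linear_combination ih - h2

end IsToeplitzOrthogonal
end Algebra

section Weight

/-- The modified circular Jacobi weight. -/
noncomputable def modifiedJacobiWeight (t lam θ : ℝ) : ℝ :=
  Real.exp (t * Real.cos θ) * (Real.sin (θ / 2) ^ 2) ^ lam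

variable (t : ℝ) {lam : ℝ}

theorem modifiedJacobiWeight_two_pi_sub (lam θ : ℝ) :
    modifiedJacobiWeight t lam (2 * Real.pi - θ) = modifiedJacobiWeight t lam θ := by
  rw [modifiedJacobiWeight, modifiedJacobiWeight, Real.cos_two_pi_sub,
    show (2 * Real.pi - θ) / 2 = Real.pi - θ / 2 by ring, Real.sin_pi_sub]

theorem sin_half_pos {θ : ℝ} (hθ : θ ∈ Set.Ioo 0 (2 * Real.pi)) : 0 < Real.sin (θ / 2) :=
  Real.sin_pos_of_pos_of_lt_pi (by linarith [hθ.1]) (by linarith [hθ.2])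

theorem modifiedJacobiWeight_nonneg (lam θ : ℝ) : 0 ≤ modifiedJacobiWeight t lam θ :=
  mul_nonneg (Real.exp_pos _).le (Real.rpow_nonneg (sq_nonneg _) _)

theorem modifiedJacobiWeight_pos (lam : ℝ) {θ : ℝ} (hθ : θ ∈ Set.Ioo 0 (2 * Real.pi)) :
    0 < modifiedJacobiWeight t lam θ :=
  mul_pos (Real.exp_pos _) (Real.rpow_pos_of_pos (pow_pos (sin_half_pos hθ) 2) _)

theorem intervalIntegrable_sin_half_sq_rpow (hlam : -1 / 2 < lam) :
    IntervalIntegrable (fun θ : ℝ => (Real.sin (θ / 2) ^ 2) ^ lam) volume 0 (2 * Real.pi) := by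
  have hpi := Real.pi_pos
  have key : IntervalIntegrable (fun θ : ℝ => (Real.sin (θ / 2) ^ 2) ^ lam) volume 0 Real.pi := by
    rcases le_or_gt 0 lam with h0 | h0
    · exact (Continuous.rpow_const (by fun_prop) fun _ => Or.inr h0).intervalIntegrable _ _
    · refine ((intervalIntegral.intervalIntegrable_rpow' (r := 2 * lam) (by linarith)).const_mul
        ((Real.pi ^ (2 * lam))⁻¹)).mono_fun'
        (by fun_prop : Measurable _).aestronglyMeasurable ?_
      rw [Set.uIoc_of_le hpi.le]
      refine (ae_restrict_iff' measurableSet_Ioc).mpr (.of_forall fun θ hθ => ?_)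
      have h1 : θ / Real.pi ≤ Real.sin (θ / 2) := by
        have := Real.mul_le_sin (x := θ / 2) (by linarith [hθ.1]) (by linarith [hθ.2])
        calc θ / Real.pi = 2 / Real.pi * (θ / 2) := by ring
          _ ≤ _ := this
      have h2 : 0 < θ / Real.pi := div_pos hθ.1 hpi
      simp only
      rw [Real.norm_of_nonneg (Real.rpow_nonneg (sq_nonneg _) _)]
      calc (Real.sin (θ / 2) ^ 2) ^ lam ≤ ((θ / Real.pi) ^ 2) ^ lam :=
            Real.rpow_le_rpow_of_nonpos (by positivity) (pow_le_pow_left₀ h2.le h1 2) h0.le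
        _ = (Real.pi ^ (2 * lam))⁻¹ * θ ^ (2 * lam) := by
            rw [← Real.rpow_natCast_mul h2.le, Real.div_rpow hθ.1.le hpi.le]
            push_cast
            ring
  have key' := (key.comp_sub_left (2 * Real.pi)).symm
  rw [show 2 * Real.pi - Real.pi = Real.pi by ring, sub_zero] at key'
  refine key.trans (key'.congr fun θ _ => ?_)
  rw [show (2 * Real.pi - θ) / 2 = Real.pi - θ / 2 by ring, Real.sin_pi_sub]

theorem intervalIntegrable_mul_modifiedJacobiWeight (hlam : -1 / 2 < lam) {g : ℝ → ℂ}
    (hg : Continuous g) :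
    IntervalIntegrable (fun θ => g θ * (modifiedJacobiWeight t lam θ : ℂ)) volume
      0 (2 * Real.pi) := by
  have h1 : IntervalIntegrable (fun θ : ℝ => (((Real.sin (θ / 2) ^ 2) ^ lam : ℝ) : ℂ)) volume
      0 (2 * Real.pi) :=
    ⟨(intervalIntegrable_sin_half_sq_rpow hlam).1.ofReal,
      (intervalIntegrable_sin_half_sq_rpow hlam).2.ofReal⟩
  have h2 : Continuous fun θ : ℝ => g θ * (Real.exp (t * Real.cos θ) : ℂ) :=
    hg.mul (by fun_prop)
  refine (h1.continuousOn_mul h2.continuousOn).congr fun θ _ => ?_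
  simp only [modifiedJacobiWeight]
  push_cast
  ring

/-- The trigonometric moments of the modified circular Jacobi weight. -/
noncomputable def jacobiMoment (t lam : ℝ) (k : ℤ) : ℂ :=
  ∫ θ in (0 : ℝ)..(2 * Real.pi),
    Complex.exp (k * (θ : ℂ) * Complex.I) * (modifiedJacobiWeight t lam θ : ℂ)

theorem jacobiMoment_neg (lam : ℝ) (k : ℤ) : jacobiMoment t lam (-k) = jacobiMoment t lam k := by
  have := intervalIntegral.integral_comp_sub_left (a := 0) (b := 2 * Real.pi)
    (fun θ : ℝ => Complex.exp (k * (θ : ℂ) * Complex.I) * (modifiedJacobiWeight t lam θ : ℂ))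
    (2 * Real.pi)
  rw [sub_self, sub_zero] at this
  rw [jacobiMoment, jacobiMoment, ← this]
  congr 1
  ext θ
  rw [modifiedJacobiWeight_two_pi_sub]
  congr 1
  rw [Complex.exp_eq_exp_iff_exists_int]
  refine ⟨-k, ?_⟩
  push_cast
  ring

theorem conj_jacobiMoment (lam : ℝ) (k : ℤ) :
    (starRingEnd ℂ) (jacobiMoment t lam k) = jacobiMoment t lam k := by
  conv_rhs => rw [← jacobiMoment_neg]
  rw [jacobiMoment, jacobiMoment, ← intervalIntegral.intervalIntegral_conj]
  congr 1
  ext θ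
  simp [← Complex.exp_conj]

theorem shiftedMoment_jacobiMoment (hlam : -1 / 2 < lam) (k : ℤ) (p : ℂ[X]) :
    shiftedMoment (jacobiMoment t lam) k p = ∫ θ in (0 : ℝ)..(2 * Real.pi),
      p.eval (Complex.exp ((θ : ℂ) * Complex.I)) * Complex.exp (-(k : ℂ) * (θ : ℂ) * Complex.I) *
        (modifiedJacobiWeight t lam θ : ℂ) := by
  induction p using Polynomial.induction_on' with
  | add p q hp hq =>
    rw [map_add, hp, hq, ← intervalIntegral.integral_add
      (intervalIntegrable_mul_modifiedJacobiWeight t hlam (by fun_prop))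
      (intervalIntegrable_mul_modifiedJacobiWeight t hlam (by fun_prop))]
    simp only [eval_add, add_mul]
  | monomial i c =>
    rw [← C_mul_X_pow_eq_monomial, shiftedMoment_C_mul_X_pow, jacobiMoment,
      ← intervalIntegral.integral_const_mul]
    congr 1
    ext θ
    rw [eval_C_mul, eval_pow, eval_X, ← Complex.exp_nat_mul, mul_assoc c, ← Complex.exp_add,
      mul_assoc c]
    congr 3
    push_cast
    ring

theorem integral_norm_sq_pos (hlam : -1 / 2 < lam) {p : ℂ[X]} (hp : p ≠ 0) :
    0 < ∫ θ in (0 : ℝ)..(2 * Real.pi),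
      ‖p.eval (Complex.exp ((θ : ℂ) * Complex.I))‖ ^ 2 * modifiedJacobiWeight t lam θ := by
  have hpi := Real.two_pi_pos
  have hint : IntervalIntegrable (fun θ : ℝ => ‖p.eval (Complex.exp ((θ : ℂ) * Complex.I))‖ ^ 2 *
      modifiedJacobiWeight t lam θ) volume 0 (2 * Real.pi) := by
    have h2 : Continuous fun θ : ℝ => ‖p.eval (Complex.exp ((θ : ℂ) * Complex.I))‖ ^ 2 *
      (Real.exp (t * Real.cos θ)) := by fun_prop
    refine ((intervalIntegrable_sin_half_sq_rpow hlam).continuousOn_mul h2.continuousOn).congr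
      fun θ _ => ?_
    simp only [modifiedJacobiWeight]
    ring
  rw [intervalIntegral.integral_pos_iff_support_of_nonneg_ae
    (.of_forall fun θ => mul_nonneg (sq_nonneg _) (modifiedJacobiWeight_nonneg t lam θ)) hint]
  refine ⟨hpi, ?_⟩
  set Z : Set ℝ := {θ ∈ Set.Ioo 0 (2 * Real.pi) |
    p.eval (Complex.exp ((θ : ℂ) * Complex.I)) = 0} with hZ
  have hZfin : Z.Finite := by
    refine Set.Finite.of_finite_image (f := fun θ : ℝ => Complex.exp ((θ : ℂ) * Complex.I))
      ((p.rootSet_finite ℂ).subset ?_) ?_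
    · rintro _ ⟨θ, hθ, rfl⟩
      rw [mem_rootSet]
      exact ⟨hp, by simpa using hθ.2⟩
    · intro x hx y hy hxy
      obtain ⟨m, hm⟩ := Complex.exp_eq_exp_iff_exists_int.mp hxy
      have hm' : x = y + m * (2 * Real.pi) := by
        have := congrArg Complex.im hm
        simpa using this
      have h1 := hx.1.1; have h2 := hx.1.2; have h3 := hy.1.1; have h4 := hy.1.2
      have hm0 : m = 0 := by
        have a1 : (m : ℝ) < 1 := by by_contra! hc; nlinarith
        have a2 : (-1 : ℝ) < m := by by_contra! hc; nlinarith
        have a3 : m < 1 := by exact_mod_cast a1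
        have a4 : -1 < m := by exact_mod_cast a2
        omega
      simpa [hm0] using hm'
  have hsub : Set.Ioo 0 (2 * Real.pi) \ Z ⊆ (Function.support fun θ : ℝ =>
      ‖p.eval (Complex.exp ((θ : ℂ) * Complex.I))‖ ^ 2 * modifiedJacobiWeight t lam θ) ∩
        Set.Ioc 0 (2 * Real.pi) := by
    rintro θ ⟨hθ, hθZ⟩
    refine ⟨mul_ne_zero (pow_ne_zero 2 (norm_ne_zero_iff.mpr fun h0 => hθZ ⟨hθ, h0⟩))
      (modifiedJacobiWeight_pos t lam hθ).ne', Set.Ioo_subset_Ioc_self hθ⟩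
  refine lt_of_lt_of_le ?_ (measure_mono hsub)
  rw [measure_sdiff_null (hZfin.measure_zero _), Real.volume_Ioo]
  simpa using hpi

theorem integral_norm_sq_eq_sum (hlam : -1 / 2 < lam) {p : ℂ[X]} {n : ℕ} (hp : p.natDegree ≤ n) :
    ((∫ θ in (0 : ℝ)..(2 * Real.pi), ‖p.eval (Complex.exp ((θ : ℂ) * Complex.I))‖ ^ 2 *
      modifiedJacobiWeight t lam θ : ℝ) : ℂ) =
      ∑ k ∈ Finset.range (n + 1), (starRingEnd ℂ) (p.coeff k) *
        shiftedMoment (jacobiMoment t lam) k p := by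
  simp_rw [shiftedMoment_jacobiMoment t hlam, ← intervalIntegral.integral_const_mul]
  rw [← intervalIntegral.integral_finsetSum fun k _ =>
    (intervalIntegrable_mul_modifiedJacobiWeight t hlam (by fun_prop)).const_mul _,
    ← intervalIntegral.integral_ofReal]
  congr 1
  ext θ
  push_cast
  rw [← Complex.mul_conj', mul_right_comm]
  conv_lhs => enter [2, 2]; rw [p.eval_eq_sum_range' (Nat.lt_succ_of_le hp)]
  rw [map_sum, Finset.mul_sum]
  refine Finset.sum_congr rfl fun k _ => ?_
  rw [map_mul, map_pow, ← Complex.exp_conj, ← Complex.exp_nat_mul]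
  simp only [map_mul, Complex.conj_ofReal, Complex.conj_I]
  rw [show (k : ℂ) * (θ * -Complex.I) = -k * θ * Complex.I by ring]
  ring

theorem hasDerivAt_jacobi_primitive (lam : ℝ) (k : ℤ) {θ : ℝ}
    (hθ : θ ∈ Set.Ioo 0 (2 * Real.pi)) :
    HasDerivAt (fun θ : ℝ => 2 * Complex.I * Complex.exp ((k + 1 / 2) * (θ : ℂ) * Complex.I) *
      ((Real.exp (t * Real.cos θ) * Real.sin (θ / 2) ^ (2 * lam + 1) : ℝ) : ℂ))
      (Complex.I * ((k + 1 + lam) * Complex.exp (((k + 1 : ℤ) : ℂ) * (θ : ℂ) * Complex.I) +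
        (lam - k) * Complex.exp (k * (θ : ℂ) * Complex.I) +
        t / 2 * (Complex.exp (((k + 2 : ℤ) : ℂ) * (θ : ℂ) * Complex.I) -
          Complex.exp (((k + 1 : ℤ) : ℂ) * (θ : ℂ) * Complex.I) -
          Complex.exp (k * (θ : ℂ) * Complex.I) +
          Complex.exp (((k - 1 : ℤ) : ℂ) * (θ : ℂ) * Complex.I))) *
        (modifiedJacobiWeight t lam θ : ℂ)) θ := by
  have hs := sin_half_pos hθ
  have hA : HasDerivAt (fun θ : ℝ => 2 * Complex.I *
      Complex.exp ((k + 1 / 2) * (θ : ℂ) * Complex.I)) _ θ :=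
    ((((hasDerivAt_id (θ : ℂ)).const_mul ((k : ℂ) + 1 / 2)).mul_const
      Complex.I).cexp.const_mul (2 * Complex.I)).comp_ofReal
  have hB : HasDerivAt (fun θ : ℝ => Real.exp (t * Real.cos θ) *
      Real.sin (θ / 2) ^ (2 * lam + 1)) _ θ :=
    (((Real.hasDerivAt_cos θ).const_mul t).exp).mul
      ((((hasDerivAt_id θ).div_const 2).sin).rpow_const (p := 2 * lam + 1) (Or.inl hs.ne'))
  have hr : Real.sin (θ / 2) ^ (2 * lam) = (Real.sin (θ / 2) ^ 2) ^ lam := by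
    rw [← Real.rpow_natCast_mul hs.le]
    norm_num
  refine (hA.mul hB.ofReal_comp).congr_deriv ?_
  simp only [id, mul_one, add_sub_cancel_right]
  rw [Real.rpow_add_one hs.ne', hr, modifiedJacobiWeight]
  generalize (Real.sin (θ / 2) ^ 2) ^ lam = r
  set u := Complex.exp (θ / 2 * Complex.I) with hu
  set v := Complex.exp (-(θ / 2) * Complex.I) with hv
  have huv : u * v = 1 := by
    rw [hu, hv, ← Complex.exp_add]
    simp
  have hsin : Real.sin θ = 2 * Real.sin (θ / 2) * Real.cos (θ / 2) := by
    rw [← Real.sin_two_mul]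
    ring_nf
  have hsu : (Real.sin (θ / 2) : ℂ) = (v - u) * Complex.I / 2 := by
    push_cast
    rw [Complex.sin]
  have hcu : (Real.cos (θ / 2) : ℂ) = (u + v) / 2 := by
    push_cast
    rw [Complex.cos]
  rw [hsin]
  set x := Real.exp (t * Real.cos θ)
  set E := Complex.exp (k * (θ : ℂ) * Complex.I) with hE
  have e1 : Complex.exp ((k + 1 / 2) * (θ : ℂ) * Complex.I) = E * u := by
    rw [hE, hu, ← Complex.exp_add]
    ring_nf
  have e2 : Complex.exp (((k + 1 : ℤ) : ℂ) * (θ : ℂ) * Complex.I) = E * u ^ 2 := by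
    rw [hE, hu, ← Complex.exp_nat_mul, ← Complex.exp_add]
    push_cast
    ring_nf
  have e3 : Complex.exp (((k + 2 : ℤ) : ℂ) * (θ : ℂ) * Complex.I) = E * u ^ 4 := by
    rw [hE, hu, ← Complex.exp_nat_mul, ← Complex.exp_add]
    push_cast
    ring_nf
  have e4 : Complex.exp (((k - 1 : ℤ) : ℂ) * (θ : ℂ) * Complex.I) = E * v ^ 2 := by
    rw [hE, hv, ← Complex.exp_nat_mul, ← Complex.exp_add]
    push_cast
    ring_nf
  simp only [Complex.ofReal_mul, Complex.ofReal_add, Complex.ofReal_neg, Complex.ofReal_div,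
    hsu, hcu, e1, e2, e3, e4, Complex.ofReal_ofNat, Complex.ofReal_one]
  clear_value u v E x
  linear_combination
    Complex.I * E * x * r * ((k + 1 / 2) * u * (v - u) - 1 / 2 * t * u * (v - u) ^ 2 * (u + v)) *
      Complex.I_sq +
    Complex.I * E * x * r * ((lam - k) + t / 2 * (v ^ 2 - u ^ 2 - u * v - 1)) * huv

theorem jacobiMoment_recurrence (hlam : -1 / 2 < lam) (k : ℤ) :
    (k + 1 + lam) * jacobiMoment t lam (k + 1) + (lam - k) * jacobiMoment t lam k +
      t / 2 * (jacobiMoment t lam (k + 2) - jacobiMoment t lam (k + 1) - jacobiMoment t lam k +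
        jacobiMoment t lam (k - 1)) = 0 := by
  have hi (j : ℤ) := intervalIntegrable_mul_modifiedJacobiWeight t hlam
    (g := fun θ : ℝ => Complex.exp (j * (θ : ℂ) * Complex.I)) (by fun_prop)
  have hF := intervalIntegral.integral_eq_sub_of_hasDerivAt_of_le Real.two_pi_pos.le
    (Continuous.continuousOn (Continuous.mul (by fun_prop) (Complex.continuous_ofReal.comp
      (Continuous.mul (by fun_prop) (Continuous.rpow_const (by fun_prop)
        fun _ => Or.inr (by linarith))))))
    (fun θ hθ => hasDerivAt_jacobi_primitive t lam k hθ)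
    (intervalIntegrable_mul_modifiedJacobiWeight t hlam (by fun_prop))
  have h0 : (2 * lam + 1) ≠ 0 := by linarith
  simp only [Pi.mul_apply, Function.comp_apply,
    mul_div_cancel_left₀ Real.pi (two_ne_zero' ℝ), Real.sin_pi, zero_div, Real.sin_zero,
    Real.zero_rpow h0, mul_zero, Complex.ofReal_zero, sub_zero] at hF
  have hsum : (∫ θ in (0 : ℝ)..(2 * Real.pi), Complex.I *
      ((k + 1 + lam) * Complex.exp (((k + 1 : ℤ) : ℂ) * (θ : ℂ) * Complex.I) +
        (lam - k) * Complex.exp (k * (θ : ℂ) * Complex.I) +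
        t / 2 * (Complex.exp (((k + 2 : ℤ) : ℂ) * (θ : ℂ) * Complex.I) -
          Complex.exp (((k + 1 : ℤ) : ℂ) * (θ : ℂ) * Complex.I) -
          Complex.exp (k * (θ : ℂ) * Complex.I) +
          Complex.exp (((k - 1 : ℤ) : ℂ) * (θ : ℂ) * Complex.I))) *
        (modifiedJacobiWeight t lam θ : ℂ)) =
      Complex.I * ((k + 1 + lam) * jacobiMoment t lam (k + 1) +
        (lam - k) * jacobiMoment t lam k +
        t / 2 * (jacobiMoment t lam (k + 2) - jacobiMoment t lam (k + 1) - jacobiMoment t lam k +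
          jacobiMoment t lam (k - 1))) := by
    simp only [jacobiMoment]
    rw [← intervalIntegral.integral_sub (hi _) (hi _),
      ← intervalIntegral.integral_sub ((hi _).sub (hi _)) (hi _),
      ← intervalIntegral.integral_add (((hi _).sub (hi _)).sub (hi _)) (hi _),
      ← intervalIntegral.integral_const_mul, ← intervalIntegral.integral_const_mul,
      ← intervalIntegral.integral_const_mul,
      ← intervalIntegral.integral_add ((hi _).const_mul _) ((hi _).const_mul _),
      ← intervalIntegral.integral_add (((hi _).const_mul _).add ((hi _).const_mul _))
        (((((hi _).sub (hi _)).sub (hi _)).add (hi _)).const_mul _),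
      ← intervalIntegral.integral_const_mul]
    congr 1
    ext θ
    ring
  rw [hsum] at hF
  exact (mul_eq_zero.mp hF).resolve_left Complex.I_ne_zero

theorem isToeplitzOrthogonal_jacobiMoment (hlam : -1 / 2 < lam) {P : ℕ → ℂ[X]}
    (hmonic : ∀ n, (P n).Monic) (hdeg : ∀ n, (P n).natDegree = n)
    (horth : ∀ n k : ℕ, k < n → shiftedMoment (jacobiMoment t lam) k (P n) = 0) :
    IsToeplitzOrthogonal (jacobiMoment t lam) P where
  symm := jacobiMoment_neg t lam
  nondegenerate n E hE hk := by
    by_contra h0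
    have h1 := integral_norm_sq_pos t hlam h0
    have h2 := integral_norm_sq_eq_sum t hlam (le_refl E.natDegree)
    rw [Finset.sum_eq_zero, Complex.ofReal_eq_zero] at h2
    · exact h1.ne' h2
    · intro k hkE
      rw [degree_eq_natDegree h0, Nat.cast_lt] at hE
      rw [hk k (by grind), mul_zero]
  monic := hmonic
  natDegree_eq := hdeg
  orthogonal := horth

variable {t}

theorem exists_norm_eq_ofReal (hlam : -1 / 2 < lam) {P : ℕ → ℂ[X]}
    (h : IsToeplitzOrthogonal (jacobiMoment t lam) P) (n : ℕ) :
    ∃ r : ℝ, 0 < r ∧ shiftedMoment (jacobiMoment t lam) n (P n) = r := by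
  refine ⟨_, integral_norm_sq_pos t hlam (h.monic n).ne_zero, ?_⟩
  rw [integral_norm_sq_eq_sum t hlam (h.natDegree_eq n).le, Finset.sum_range_succ,
    Finset.sum_eq_zero, h.coeff_self]
  · simp
  · intro k hk
    rw [h.orthogonal n k (Finset.mem_range.mp hk), mul_zero]

theorem shiftedMoment_jacobiMoment_map_conj (k : ℤ) (p : ℂ[X]) :
    shiftedMoment (jacobiMoment t lam) k (p.map (starRingEnd ℂ)) =
      (starRingEnd ℂ) (shiftedMoment (jacobiMoment t lam) k p) := by
  induction p using Polynomial.induction_on' with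
  | add p q hp hq => rw [Polynomial.map_add, map_add, map_add, hp, hq, map_add]
  | monomial i c =>
    rw [map_monomial, ← C_mul_X_pow_eq_monomial, ← C_mul_X_pow_eq_monomial,
      shiftedMoment_C_mul_X_pow, shiftedMoment_C_mul_X_pow, map_mul, conj_jacobiMoment]

theorem map_conj_eq_self {P : ℕ → ℂ[X]} (h : IsToeplitzOrthogonal (jacobiMoment t lam) P)
    (n : ℕ) : (P n).map (starRingEnd ℂ) = P n := by
  rw [← sub_eq_zero]
  refine h.nondegenerate n _ ?_ fun k hk => ?_
  · rw [degree_lt_iff_coeff_zero]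
    intro m hm
    rw [coeff_sub, coeff_map]
    rcases eq_or_lt_of_le hm with rfl | hm
    · rw [h.coeff_self, map_one, sub_self]
    · rw [coeff_eq_zero_of_natDegree_lt (by rwa [h.natDegree_eq]), map_zero, sub_self]
  · rw [map_sub, shiftedMoment_jacobiMoment_map_conj, h.orthogonal n k hk, map_zero, sub_self]

theorem exists_coeff_zero_eq_ofReal (hlam : -1 / 2 < lam) {P : ℕ → ℂ[X]}
    (h : IsToeplitzOrthogonal (jacobiMoment t lam) P) (n : ℕ) :
    ∃ r : ℝ, (P (n + 1)).coeff 0 = r ∧ |r| < 1 := by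
  obtain ⟨r, hr⟩ := Complex.conj_eq_iff_real.mp
    (by rw [← coeff_map, map_conj_eq_self h] : (starRingEnd ℂ) ((P (n + 1)).coeff 0) = _)
  obtain ⟨a, ha, hae⟩ := exists_norm_eq_ofReal hlam h n
  obtain ⟨b, hb, hbe⟩ := exists_norm_eq_ofReal hlam h (n + 1)
  refine ⟨r, hr, ?_⟩
  have := h.norm_succ n
  rw [hae, hbe, hr] at this
  have h1 : b = (1 - r ^ 2) * a := by exact_mod_cast this
  rw [← sq_lt_one_iff_abs_lt_one]
  nlinarith [pos_of_mul_pos_left (h1 ▸ hb) ha.le]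

end Weight

theorem stmt_16
    (t lam : ℝ) (ht : t ≠ 0) (hlam : -1/2 < lam)
    (w : ℝ → ℝ)
    (hw : ∀ θ : ℝ, w θ = Real.exp (t * Real.cos θ) * (Real.sin (θ/2)^2) ^ lam)
    (Φ : ℕ → Polynomial ℂ)
    (hmonic : ∀ n, (Φ n).Monic)
    (hdeg : ∀ n, (Φ n).natDegree = n)
    (horth : ∀ n, ∀ k < n,
      ∫ θ in (0:ℝ)..(2*Real.pi),
        (Φ n).eval (Complex.exp ((θ:ℂ) * Complex.I)) *
          Complex.exp (-(k : ℂ) * (θ:ℂ) * Complex.I) * (w θ : ℂ) = 0)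
    (α : ℕ → ℂ)
    (hα : ∀ m, α m = -(starRingEnd ℂ) ((Φ (m+1)).coeff 0))
    :
    (∀ m, ∃ r : ℝ, α m = (r : ℂ) ∧ |r| < 1)
    ∧ ∀ n : ℕ, 3 ≤ n →
      α n + α (n-2) = -(2/(t:ℂ)) * (((lam:ℂ) + ((lam:ℂ) + (n:ℂ)) * α (n-1)) / (1 - (α (n-1))^2)) := by
  obtain rfl : w = modifiedJacobiWeight t lam := funext hw
  have h : IsToeplitzOrthogonal (jacobiMoment t lam) Φ :=
    isToeplitzOrthogonal_jacobiMoment t hlam hmonic hdeg fun n k hk => by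
      rw [shiftedMoment_jacobiMoment t hlam]
      exact_mod_cast horth n k hk
  have hα' (m : ℕ) : α m = -(Φ (m + 1)).coeff 0 := by
    rw [hα, ← coeff_map, map_conj_eq_self h]
  have hreal (m : ℕ) : ∃ r : ℝ, α m = (r : ℂ) ∧ |r| < 1 := by
    obtain ⟨r, hr, hr1⟩ := exists_coeff_zero_eq_ofReal hlam h m
    exact ⟨-r, by rw [hα', hr, Complex.ofReal_neg], by rwa [abs_neg]⟩
  refine ⟨hreal, fun n hn => ?_⟩
  obtain ⟨m, rfl⟩ : ∃ m, n = m + 2 := ⟨n - 2, by omega⟩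
  have hp := h.painleve (jacobiMoment_recurrence t hlam) (m + 1)
  obtain ⟨r, hr, hr1⟩ := hreal (m + 1)
  have hne : 1 - α (m + 1) ^ 2 ≠ 0 := by
    rw [hr]
    have := (sq_lt_one_iff_abs_lt_one r).mpr hr1
    exact_mod_cast (sub_pos.mpr this).ne'
  have ht' : (t : ℂ) ≠ 0 := by exact_mod_cast ht
  have hc (j : ℕ) : (Φ (j + 1)).coeff 0 = -α j := by rw [hα', neg_neg]
  rw [hc, show m + 1 + 2 = m + 2 + 1 by ring, hc, hc] at hp
  rw [Nat.add_sub_cancel, show m + 2 - 1 = m + 1 by omega]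
  field_simp
  push_cast at hp ⊢
  linear_combination -2 * hp
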